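/- arXiv:2005.08687 — 9 statements merged into one kernel-verified Lean document; each statement's English description precedes it below -/
import Mathlib

section
/- Let w_1, ..., w_M be vectors in ℝ^n and let C be the convex cone they generate. Let G be a real m×n matrix, let K be the dimension of the kernel of G, and let T : ℝ^K → ℝ^n be an injective linear map whose range equals the kernel of G. Suppose b ∈ ℝ^n is a facet normal vector of C (i.e., b ≠ 0, ⟨w_i, b⟩ ≥ 0 for all i, and the linear span of {w_i : ⟨w_i, b⟩ = 0} has dimension n−1) satisfying G b = 0, and let b̃ ∈ ℝ^K be the (unique) vector with b = T b̃. Define w̃_i = Tᵀ w_i ∈ ℝ^K (the transpose/adjoint of T applied to w_i). Then b̃ is a facet normal vector of the cone generated by w̃_1, ..., w̃_M: b̃ ≠ 0, ⟨w̃_i, b̃⟩ ≥ 0 for all i, and the linear span of {w̃_i : ⟨w̃_i, b̃⟩ = 0} has dimension K−1. -/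
open Matrix

/-- The hyperplane orthogonal to a nonzero vector of `ℝ^n` has dimension `n - 1`. -/
lemma finrank_ker_dotProductEquiv {n : ℕ} {b : Fin n → ℝ} (hb : b ≠ 0) :
    Module.finrank ℝ (LinearMap.ker (dotProductEquiv ℝ (Fin n) b)) = n - 1 := by
  have h := Module.Dual.finrank_ker_add_one_of_ne_zero
    (f := dotProductEquiv ℝ (Fin n) b) (by simpa using hb)
  rw [Module.finrank_fin_fun] at h
  omega

/-- The transpose of an injective matrix is surjective. -/
lemma transpose_mulVec_surjective {n K : ℕ} {T : Matrix (Fin n) (Fin K) ℝ}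
    (hT : Function.Injective T.mulVecLin) : Function.Surjective Tᵀ.mulVecLin := by
  rw [← LinearMap.range_eq_top]
  apply Submodule.eq_top_of_finrank_eq
  change Tᵀ.rank = _
  rw [rank_transpose, rank, LinearMap.finrank_range_of_inj hT]

/-- The adjoint relation between a matrix and its transpose. -/
lemma transpose_mulVec_dotProduct {n K : ℕ} (T : Matrix (Fin n) (Fin K) ℝ)
    (x : Fin n → ℝ) (y : Fin K → ℝ) : Tᵀ *ᵥ x ⬝ᵥ y = x ⬝ᵥ T *ᵥ y := by
  rw [mulVec_transpose, dotProduct_mulVec]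

/-- If `b` is a facet normal vector of the cone generated by the `w i` satisfying the
linear constraint `G b = 0`, and `T` is an injective linear map (given as a matrix)
whose range is the kernel of `G`, with `b = T b̃`, then `b̃` is a facet normal
vector of the cone generated by the projected rays `w̃ i = Tᵀ (w i)`. -/
theorem stmt_0 (n m K M : ℕ)
    (w : Fin M → (Fin n → ℝ))
    (G : Matrix (Fin m) (Fin n) ℝ)
    (T : Matrix (Fin n) (Fin K) ℝ)
    (hTinj : Function.Injective T.mulVecLin)
    (hTrange : LinearMap.range T.mulVecLin = LinearMap.ker G.mulVecLin)
    (hK : K = Module.finrank ℝ (LinearMap.ker G.mulVecLin))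
    (b : Fin n → ℝ) (hb0 : b ≠ 0)
    (hvalid : ∀ i, 0 ≤ w i ⬝ᵥ b)
    (hfacet : Module.finrank ℝ
      (Submodule.span ℝ {x : Fin n → ℝ | ∃ i, x = w i ∧ w i ⬝ᵥ b = 0}) = n - 1)
    (hGb : G.mulVec b = 0)
    (bt : Fin K → ℝ) (hbt : T.mulVec bt = b) :
    bt ≠ 0 ∧ (∀ i, 0 ≤ Tᵀ.mulVec (w i) ⬝ᵥ bt) ∧
      Module.finrank ℝ (Submodule.span ℝ
        {x : Fin K → ℝ | ∃ i, x = Tᵀ.mulVec (w i) ∧ Tᵀ.mulVec (w i) ⬝ᵥ bt = 0}) = K - 1 := by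
  subst hbt
  have hbt0 : bt ≠ 0 := by
    rintro rfl
    simp at hb0
  refine ⟨hbt0, fun i ↦ by simpa only [transpose_mulVec_dotProduct] using hvalid i, ?_⟩
  have hspan : Submodule.span ℝ {x | ∃ i, x = w i ∧ w i ⬝ᵥ T *ᵥ bt = 0} =
      LinearMap.ker (dotProductEquiv ℝ (Fin n) (T *ᵥ bt)) := by
    apply Submodule.eq_of_le_of_finrank_eq
    · rw [Submodule.span_le]
      rintro _ ⟨i, rfl, hi⟩
      simpa [dotProduct_comm] using hi
    · rw [hfacet, finrank_ker_dotProductEquiv hb0]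
  have himage : {x | ∃ i, x = Tᵀ *ᵥ w i ∧ Tᵀ *ᵥ w i ⬝ᵥ bt = 0} =
      Tᵀ.mulVecLin '' {x | ∃ i, x = w i ∧ w i ⬝ᵥ T *ᵥ bt = 0} := by
    ext x
    simp only [transpose_mulVec_dotProduct]
    constructor
    · rintro ⟨i, rfl, hi⟩
      exact ⟨w i, ⟨i, rfl, hi⟩, rfl⟩
    · rintro ⟨_, ⟨i, rfl, hi⟩, rfl⟩
      exact ⟨i, rfl, hi⟩
  have hcomap : LinearMap.ker (dotProductEquiv ℝ (Fin n) (T *ᵥ bt)) =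
      (LinearMap.ker (dotProductEquiv ℝ (Fin K) bt)).comap Tᵀ.mulVecLin := by
    ext x
    simp only [LinearMap.mem_ker, Submodule.mem_comap, dotProductEquiv_apply_apply,
      mulVecLin_apply]
    rw [dotProduct_comm, dotProduct_comm bt, transpose_mulVec_dotProduct]
  rw [himage, Submodule.span_image, hspan, hcomap,
    Submodule.map_comap_eq_of_surjective (transpose_mulVec_surjective hTinj),
    finrank_ker_dotProductEquiv hbt0]
end

section
/- For all real numbers a_1, a_2, a_3, b_1, b_2, b_3 in the interval [−1, 1], the I3322 expression satisfies a_1 − a_2 + b_1 − b_2 − (a_1 − a_2)(b_1 − b_2) + (a_1 + a_2) b_3 + a_3 (b_1 + b_2) ≤ 4. -/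
/-- For `s, t, u ∈ [-1, 1]`, the product `(s + t) * u` is at most `2 - |s - t|`. -/
theorem add_mul_le_two_sub_abs_sub {s t u : ℝ} (hs : s ∈ Set.Icc (-1 : ℝ) 1)
    (ht : t ∈ Set.Icc (-1 : ℝ) 1) (hu : u ∈ Set.Icc (-1 : ℝ) 1) :
    (s + t) * u ≤ 2 - |s - t| := by
  obtain ⟨hs₁, hs₂⟩ := hs
  obtain ⟨ht₁, ht₂⟩ := ht
  have hmul : (s + t) * u ≤ |s + t| := by
    calc (s + t) * u ≤ |(s + t) * u| := le_abs_self _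
      _ = |s + t| * |u| := abs_mul _ _
      _ ≤ |s + t| := mul_le_of_le_one_right (abs_nonneg _) (abs_le.mpr hu)
  have habs : |s + t| + |s - t| ≤ 2 := by
    rcases abs_cases (s + t) with h | h <;> rcases abs_cases (s - t) with h' | h' <;> linarith
  linarith

/-- For `x, y ∈ [-2, 2]`, the function `x + y - x * y` is at most `|x| + |y|`. -/
theorem add_sub_mul_le_abs_add_abs {x y : ℝ} (hx : x ∈ Set.Icc (-2 : ℝ) 2)
    (hy : y ∈ Set.Icc (-2 : ℝ) 2) : x + y - x * y ≤ |x| + |y| := by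
  obtain ⟨hx₁, hx₂⟩ := hx
  obtain ⟨hy₁, hy₂⟩ := hy
  rcases abs_cases x with ⟨h, hx₀⟩ | ⟨h, hx₀⟩ <;>
    rcases abs_cases y with ⟨h', hy₀⟩ | ⟨h', hy₀⟩ <;> rw [h, h'] <;> nlinarith

/-- The I3322 (Froissart) Bell inequality for local deterministic assignments. -/
theorem stmt_6 (a₁ a₂ a₃ b₁ b₂ b₃ : ℝ)
    (ha₁ : a₁ ∈ Set.Icc (-1 : ℝ) 1) (ha₂ : a₂ ∈ Set.Icc (-1 : ℝ) 1)
    (ha₃ : a₃ ∈ Set.Icc (-1 : ℝ) 1)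
    (hb₁ : b₁ ∈ Set.Icc (-1 : ℝ) 1) (hb₂ : b₂ ∈ Set.Icc (-1 : ℝ) 1)
    (hb₃ : b₃ ∈ Set.Icc (-1 : ℝ) 1) :
    a₁ - a₂ + b₁ - b₂ - (a₁ - a₂) * (b₁ - b₂) + (a₁ + a₂) * b₃ + a₃ * (b₁ + b₂) ≤ 4 := by
  have ha := add_mul_le_two_sub_abs_sub ha₁ ha₂ hb₃
  have hb := add_mul_le_two_sub_abs_sub hb₁ hb₂ ha₃
  have hab : (a₁ - a₂) + (b₁ - b₂) - (a₁ - a₂) * (b₁ - b₂) ≤ |a₁ - a₂| + |b₁ - b₂| :=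
    add_sub_mul_le_abs_add_abs
      ⟨by linarith [ha₁.1, ha₂.2], by linarith [ha₁.2, ha₂.1]⟩
      ⟨by linarith [hb₁.1, hb₂.2], by linarith [hb₁.2, hb₂.1]⟩
  linarith
end

section
/- For all real numbers a_1, a_2, b_1, b_2, c_1, c_2 in the interval [−1, 1], the Mermin expression satisfies a_1 b_1 c_2 + a_1 b_2 c_1 + a_2 b_1 c_1 − a_2 b_2 c_2 ≤ 2. -/
theorem abs_mul_add_mul_le_of_abs_add_le_of_abs_sub_le {x y u v r : ℝ} (hx : |x| ≤ 1)
    (hy : |y| ≤ 1) (hadd : |u + v| ≤ r) (hsub : |u - v| ≤ r) : |x * u + y * v| ≤ r :=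
  calc |x * u + y * v| ≤ |x| * |u| + |y| * |v| := by
        simpa only [abs_mul] using abs_add_le (x * u) (y * v)
    _ ≤ |u| + |v| :=
        add_le_add (mul_le_of_le_one_left (abs_nonneg u) hx)
          (mul_le_of_le_one_left (abs_nonneg v) hy)
    _ ≤ r := by
        rw [abs_le] at hadd hsub
        rcases abs_cases u with hu | hu <;> rcases abs_cases v with hv | hv <;> linarith

/-- The Mermin Bell inequality for local deterministic assignments. -/
theorem stmt_7 (a₁ a₂ b₁ b₂ c₁ c₂ : ℝ)
    (ha₁ : a₁ ∈ Set.Icc (-1 : ℝ) 1) (ha₂ : a₂ ∈ Set.Icc (-1 : ℝ) 1)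
    (hb₁ : b₁ ∈ Set.Icc (-1 : ℝ) 1) (hb₂ : b₂ ∈ Set.Icc (-1 : ℝ) 1)
    (hc₁ : c₁ ∈ Set.Icc (-1 : ℝ) 1) (hc₂ : c₂ ∈ Set.Icc (-1 : ℝ) 1) :
    a₁ * b₁ * c₂ + a₁ * b₂ * c₁ + a₂ * b₁ * c₁ - a₂ * b₂ * c₂ ≤ 2 := by
  obtain ⟨hc₁l, hc₁u⟩ := hc₁
  obtain ⟨hc₂l, hc₂u⟩ := hc₂
  have hadd : |b₁ * (c₁ + c₂) + b₂ * (c₁ - c₂)| ≤ 2 :=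
    abs_mul_add_mul_le_of_abs_add_le_of_abs_sub_le (abs_le.2 hb₁) (abs_le.2 hb₂)
      (abs_le.2 ⟨by linarith, by linarith⟩) (abs_le.2 ⟨by linarith, by linarith⟩)
  have hsub : |b₁ * (c₂ - c₁) + b₂ * (c₁ + c₂)| ≤ 2 :=
    abs_mul_add_mul_le_of_abs_add_le_of_abs_sub_le (abs_le.2 hb₁) (abs_le.2 hb₂)
      (abs_le.2 ⟨by linarith, by linarith⟩) (abs_le.2 ⟨by linarith, by linarith⟩)
  have h : |a₁ * (b₁ * c₂ + b₂ * c₁) + a₂ * (b₁ * c₁ - b₂ * c₂)| ≤ 2 :=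
    abs_mul_add_mul_le_of_abs_add_le_of_abs_sub_le (abs_le.2 ha₁) (abs_le.2 ha₂)
      (by convert hadd using 2; ring) (by convert hsub using 2; ring)
  linarith [(abs_le.1 h).2]
end

section
/- For all real numbers a_1, a_2, a_3, b_1, b_2, b_3, c_1, c_2, c_3 in the interval [−1, 1], setting E(i,j,k) = a_i b_j c_k with the convention a_0 = b_0 = c_0 = 1, the expression F1(E) is nonnegative: F1(E) ≥ 0. -/
/-- The tripartite Bell expression F1 generalizing the I3322 inequality. -/
def F1 (E : Fin 4 → Fin 4 → Fin 4 → ℝ) : ℝ :=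
  8 + (E 1 1 0 + E 1 0 1 + E 0 1 1)
    - (E 2 1 0 + E 2 0 1 + E 1 2 0 + E 0 2 1 + E 1 0 2 + E 0 1 2)
    + (E 2 1 1 + E 1 2 1 + E 1 1 2)
    + (E 2 2 0 + E 2 0 2 + E 0 2 2)
    + E 2 2 2
    - 2 * (E 3 3 1 + E 3 1 3 + E 1 3 3)
    - 2 * (E 3 3 2 + E 3 2 3 + E 2 3 3)

/-- An affine function of one variable that is nonnegative at `1` and `-1` is nonnegative
on `[-1, 1]`. -/
lemma affine_nonneg_of_endpoints {p q x : ℝ} (hx : x ∈ Set.Icc (-1 : ℝ) 1)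
    (h : ∀ u : ℤˣ, 0 ≤ p + q * ((u : ℤ) : ℝ)) : 0 ≤ p + q * x := by
  have h_pos := h 1
  have h_neg := h (-1)
  push_cast at h_pos h_neg
  nlinarith [hx.1, hx.2]

/-- An affine function of three variables that is nonnegative at the vertices of the cube
`[-1, 1]³` is nonnegative on the whole cube. -/
lemma affine_nonneg_of_vertices {p q r s x y z : ℝ} (hx : x ∈ Set.Icc (-1 : ℝ) 1)
    (hy : y ∈ Set.Icc (-1 : ℝ) 1) (hz : z ∈ Set.Icc (-1 : ℝ) 1)
    (h : ∀ u v w : ℤˣ,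
      0 ≤ p + q * ((u : ℤ) : ℝ) + r * ((v : ℤ) : ℝ) + s * ((w : ℤ) : ℝ)) :
    0 ≤ p + q * x + r * y + s * z := by
  refine affine_nonneg_of_endpoints hz fun w => ?_
  rw [add_right_comm]
  refine affine_nonneg_of_endpoints hy fun v => ?_
  rw [add_right_comm p, add_right_comm]
  refine affine_nonneg_of_endpoints hx fun u => ?_
  linarith [h u v w]

/-- `F1` of a product assignment, written as a polynomial that is affine in each party. -/
def bellPolynomial {R : Type*} [CommRing R] (a₁ a₂ a₃ b₁ b₂ b₃ c₁ c₂ c₃ : R) : R :=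
  8 + b₁ * c₁ - b₂ * c₁ - b₁ * c₂ + b₂ * c₂
    + (b₁ + c₁ - b₂ - c₂ + b₂ * c₁ + b₁ * c₂ - 2 * (b₃ * c₃)) * a₁
    + (b₂ + c₂ - b₁ - c₁ + b₁ * c₁ + b₂ * c₂ - 2 * (b₃ * c₃)) * a₂
    + -2 * (b₃ * (c₁ + c₂) + (b₁ + b₂) * c₃) * a₃

lemma bellPolynomial_rotate {R : Type*} [CommRing R] (a₁ a₂ a₃ b₁ b₂ b₃ c₁ c₂ c₃ : R) :
    bellPolynomial a₁ a₂ a₃ b₁ b₂ b₃ c₁ c₂ c₃ = bellPolynomial b₁ b₂ b₃ c₁ c₂ c₃ a₁ a₂ a₃ := by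
  unfold bellPolynomial
  ring

lemma bellPolynomial_units_nonneg : ∀ a₁ a₂ a₃ b₁ b₂ b₃ c₁ c₂ c₃ : ℤˣ,
    0 ≤ bellPolynomial (a₁ : ℤ) a₂ a₃ b₁ b₂ b₃ c₁ c₂ c₃ := by
  unfold bellPolynomial
  decide +kernel

/-- The Bell inequality `F1 ≥ 0` holds for local deterministic assignments. -/
theorem stmt_8 (a₁ a₂ a₃ b₁ b₂ b₃ c₁ c₂ c₃ : ℝ)
    (ha₁ : a₁ ∈ Set.Icc (-1 : ℝ) 1) (ha₂ : a₂ ∈ Set.Icc (-1 : ℝ) 1)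
    (ha₃ : a₃ ∈ Set.Icc (-1 : ℝ) 1)
    (hb₁ : b₁ ∈ Set.Icc (-1 : ℝ) 1) (hb₂ : b₂ ∈ Set.Icc (-1 : ℝ) 1)
    (hb₃ : b₃ ∈ Set.Icc (-1 : ℝ) 1)
    (hc₁ : c₁ ∈ Set.Icc (-1 : ℝ) 1) (hc₂ : c₂ ∈ Set.Icc (-1 : ℝ) 1)
    (hc₃ : c₃ ∈ Set.Icc (-1 : ℝ) 1) :
    0 ≤ F1 (fun i j k => ![1, a₁, a₂, a₃] i * ![1, b₁, b₂, b₃] j * ![1, c₁, c₂, c₃] k) := by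
  have h_poly : 0 ≤ bellPolynomial a₁ a₂ a₃ b₁ b₂ b₃ c₁ c₂ c₃ := by
    refine affine_nonneg_of_vertices ha₁ ha₂ ha₃ fun u₁ u₂ u₃ => ?_
    change 0 ≤ bellPolynomial _ _ _ _ _ _ _ _ _
    rw [bellPolynomial_rotate]
    refine affine_nonneg_of_vertices hb₁ hb₂ hb₃ fun v₁ v₂ v₃ => ?_
    change 0 ≤ bellPolynomial _ _ _ _ _ _ _ _ _
    rw [bellPolynomial_rotate]
    refine affine_nonneg_of_vertices hc₁ hc₂ hc₃ fun w₁ w₂ w₃ => ?_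
    have h_units := bellPolynomial_units_nonneg w₁ w₂ w₃ u₁ u₂ u₃ v₁ v₂ v₃
    unfold bellPolynomial at h_units
    exact_mod_cast h_units
  refine h_poly.trans_eq ?_
  simp only [F1, bellPolynomial, Matrix.cons_val]
  ring
end

section
/- For all real numbers a_1, a_2, a_3, b_1, b_2, b_3, c_1, c_2, c_3 in the interval [−1, 1], setting E(i,j,k) = a_i b_j c_k with the convention a_0 = b_0 = c_0 = 1, the expression F3(E) is nonnegative: F3(E) ≥ 0. -/
/-- The tripartite Bell expression F3 generalizing the I3322 inequality. -/
def F3 (E : Fin 4 → Fin 4 → Fin 4 → ℝ) : ℝ :=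
  9 - (E 2 1 0 + E 2 0 1 + E 1 2 0 + E 0 2 1 + E 1 0 2 + E 0 1 2)
    + (E 2 1 1 + E 1 2 1 + E 1 1 2)
    + (E 2 2 0 + E 2 0 2 + E 0 2 2)
    + 3 * E 2 2 2
    - (E 3 0 0 + E 0 3 0 + E 0 0 3)
    - (E 3 1 0 + E 3 0 1 + E 1 3 0 + E 0 3 1 + E 1 0 3 + E 0 1 3)
    + (E 3 1 1 + E 1 3 1 + E 1 1 3)
    - 2 * (E 3 2 2 + E 2 3 2 + E 2 2 3)

/-- A function that interpolates linearly between its values at `-1` and `1` is nonnegative on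
`[-1, 1]` if it is nonnegative at the signs `-1` and `1`. -/
theorem nonneg_of_interpolation_of_sign {f : ℝ → ℝ} {x : ℝ} (hx : x ∈ Set.Icc (-1 : ℝ) 1)
    (hf : 2 * f x = (1 + x) * f 1 + (1 - x) * f (-1))
    (h : ∀ s ∈ ({-1, 1} : Finset ℤ), 0 ≤ f s) : 0 ≤ f x := by
  have hpos : 0 ≤ f 1 := by simpa using h 1 (by simp)
  have hneg : 0 ≤ f (-1) := by simpa using h (-1) (by simp)
  have h₁ := mul_nonneg (show 0 ≤ 1 + x by linarith [hx.1]) hpos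
  have h₂ := mul_nonneg (show 0 ≤ 1 - x by linarith [hx.2]) hneg
  linarith

/-- The value of `F3` on the product assignment `E i j k = a i * b j * c k` with trivial zeroth
measurements, as a polynomial over an arbitrary commutative ring. -/
def productF3 {R : Type*} [CommRing R] (a₁ a₂ a₃ b₁ b₂ b₃ c₁ c₂ c₃ : R) : R :=
  9 - (a₂ * b₁ + a₂ * c₁ + a₁ * b₂ + b₂ * c₁ + a₁ * c₂ + b₁ * c₂)
    + (a₂ * b₁ * c₁ + a₁ * b₂ * c₁ + a₁ * b₁ * c₂)
    + (a₂ * b₂ + a₂ * c₂ + b₂ * c₂)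
    + 3 * (a₂ * b₂ * c₂)
    - (a₃ + b₃ + c₃)
    - (a₃ * b₁ + a₃ * c₁ + a₁ * b₃ + b₃ * c₁ + a₁ * c₃ + b₁ * c₃)
    + (a₃ * b₁ * c₁ + a₁ * b₃ * c₁ + a₁ * b₁ * c₃)
    - 2 * (a₃ * b₂ * c₂ + a₂ * b₃ * c₂ + a₂ * b₂ * c₃)

set_option maxRecDepth 100000 in
theorem productF3_nonneg_of_sign :
    ∀ a₁ ∈ ({-1, 1} : Finset ℤ), ∀ a₂ ∈ ({-1, 1} : Finset ℤ), ∀ a₃ ∈ ({-1, 1} : Finset ℤ),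
    ∀ b₁ ∈ ({-1, 1} : Finset ℤ), ∀ b₂ ∈ ({-1, 1} : Finset ℤ), ∀ b₃ ∈ ({-1, 1} : Finset ℤ),
    ∀ c₁ ∈ ({-1, 1} : Finset ℤ), ∀ c₂ ∈ ({-1, 1} : Finset ℤ), ∀ c₃ ∈ ({-1, 1} : Finset ℤ),
      0 ≤ productF3 a₁ a₂ a₃ b₁ b₂ b₃ c₁ c₂ c₃ := by
  unfold productF3
  decide +kernel

/-- The Bell inequality `F3 ≥ 0` holds for local deterministic assignments. -/
theorem stmt_10 (a₁ a₂ a₃ b₁ b₂ b₃ c₁ c₂ c₃ : ℝ)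
    (ha₁ : a₁ ∈ Set.Icc (-1 : ℝ) 1) (ha₂ : a₂ ∈ Set.Icc (-1 : ℝ) 1)
    (ha₃ : a₃ ∈ Set.Icc (-1 : ℝ) 1)
    (hb₁ : b₁ ∈ Set.Icc (-1 : ℝ) 1) (hb₂ : b₂ ∈ Set.Icc (-1 : ℝ) 1)
    (hb₃ : b₃ ∈ Set.Icc (-1 : ℝ) 1)
    (hc₁ : c₁ ∈ Set.Icc (-1 : ℝ) 1) (hc₂ : c₂ ∈ Set.Icc (-1 : ℝ) 1)
    (hc₃ : c₃ ∈ Set.Icc (-1 : ℝ) 1) :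
    0 ≤ F3 (fun i j k => ![1, a₁, a₂, a₃] i * ![1, b₁, b₂, b₃] j * ![1, c₁, c₂, c₃] k) := by
  suffices h : 0 ≤ productF3 a₁ a₂ a₃ b₁ b₂ b₃ c₁ c₂ c₃ by
    simpa [F3, productF3] using h
  refine nonneg_of_interpolation_of_sign (f := fun x => productF3 x a₂ a₃ b₁ b₂ b₃ c₁ c₂ c₃) ha₁
    (by simp only [productF3]; ring) fun r₁ hr₁ => ?_
  refine nonneg_of_interpolation_of_sign (f := fun x => productF3 r₁ x a₃ b₁ b₂ b₃ c₁ c₂ c₃) ha₂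
    (by simp only [productF3]; ring) fun r₂ hr₂ => ?_
  refine nonneg_of_interpolation_of_sign (f := fun x => productF3 r₁ r₂ x b₁ b₂ b₃ c₁ c₂ c₃) ha₃
    (by simp only [productF3]; ring) fun r₃ hr₃ => ?_
  refine nonneg_of_interpolation_of_sign (f := fun x => productF3 r₁ r₂ r₃ x b₂ b₃ c₁ c₂ c₃) hb₁
    (by simp only [productF3]; ring) fun s₁ hs₁ => ?_
  refine nonneg_of_interpolation_of_sign (f := fun x => productF3 r₁ r₂ r₃ s₁ x b₃ c₁ c₂ c₃) hb₂
    (by simp only [productF3]; ring) fun s₂ hs₂ => ?_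
  refine nonneg_of_interpolation_of_sign (f := fun x => productF3 r₁ r₂ r₃ s₁ s₂ x c₁ c₂ c₃) hb₃
    (by simp only [productF3]; ring) fun s₃ hs₃ => ?_
  refine nonneg_of_interpolation_of_sign (f := fun x => productF3 r₁ r₂ r₃ s₁ s₂ s₃ x c₂ c₃) hc₁
    (by simp only [productF3]; ring) fun t₁ ht₁ => ?_
  refine nonneg_of_interpolation_of_sign (f := fun x => productF3 r₁ r₂ r₃ s₁ s₂ s₃ t₁ x c₃) hc₂
    (by simp only [productF3]; ring) fun t₂ ht₂ => ?_
  refine nonneg_of_interpolation_of_sign (f := fun x => productF3 r₁ r₂ r₃ s₁ s₂ s₃ t₁ t₂ x) hc₃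
    (by simp only [productF3]; ring) fun t₃ ht₃ => ?_
  have h := productF3_nonneg_of_sign r₁ hr₁ r₂ hr₂ r₃ hr₃ s₁ hs₁ s₂ hs₂ s₃ hs₃ t₁ ht₁ t₂ ht₂ t₃ ht₃
  simp only [productF3] at h ⊢
  exact_mod_cast h
end

section
/- Let σ_x, σ_y, σ_z denote the Pauli matrices and I the 2×2 identity matrix over ℂ. Let ψ = (|000⟩ + |111⟩)/√2 ∈ ℂ^8 be the three-qubit GHZ state (where |abc⟩ denotes the corresponding standard basis vector of the threefold Kronecker product). Define A_1 = A_2 = σ_x, A_3 = σ_y, B_1 = B_2 = −σ_y, B_3 = σ_x, C_i = B_i for i = 1,2,3, and A_0 = B_0 = C_0 = I. Setting E(i,j,k) = Re⟨ψ, (A_i ⊗ B_j ⊗ C_k) ψ⟩ (Kronecker product of matrices, standard Hermitian inner product on ℂ^8), the Bell expression evaluates to F1(E) = −8. -/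
open Matrix Kronecker

namespace Stmt12

/-- The Pauli matrix σ_x. -/
def σx : Matrix (Fin 2) (Fin 2) ℂ := !![0, 1; 1, 0]

/-- The Pauli matrix σ_y. -/
def σy : Matrix (Fin 2) (Fin 2) ℂ := !![0, -Complex.I; Complex.I, 0]

/-- The three-qubit GHZ state `(|000⟩ + |111⟩)/√2`. -/
noncomputable def ψ : Fin 2 × Fin 2 × Fin 2 → ℂ := fun x =>
  if x = (0, 0, 0) ∨ x = (1, 1, 1) then ((Real.sqrt 2 : ℝ)⁻¹ : ℂ) else 0

/-- The tripartite Bell expression F1 generalizing the I3322 inequality. -/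
def F1 (E : Fin 4 → Fin 4 → Fin 4 → ℝ) : ℝ :=
  8 + (E 1 1 0 + E 1 0 1 + E 0 1 1)
    - (E 2 1 0 + E 2 0 1 + E 1 2 0 + E 0 2 1 + E 1 0 2 + E 0 1 2)
    + (E 2 1 1 + E 1 2 1 + E 1 1 2)
    + (E 2 2 0 + E 2 0 2 + E 0 2 2)
    + E 2 2 2
    - 2 * (E 3 3 1 + E 3 1 3 + E 1 3 3)
    - 2 * (E 3 3 2 + E 3 2 3 + E 2 3 3)

/-- The expectation value of a product observable in the GHZ state. -/
lemma ghz_expectation (M N P : Matrix (Fin 2) (Fin 2) ℂ) :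
    star ψ ⬝ᵥ (M ⊗ₖ (N ⊗ₖ P)).mulVec ψ =
      (M 0 0 * N 0 0 * P 0 0 + M 0 1 * N 0 1 * P 0 1
        + M 1 0 * N 1 0 * P 1 0 + M 1 1 * N 1 1 * P 1 1) / 2 := by
  have h : ((Real.sqrt 2 : ℝ) : ℂ)⁻¹ * ((Real.sqrt 2 : ℝ) : ℂ)⁻¹ = 1 / 2 := by
    rw [← mul_inv, ← Complex.ofReal_mul, Real.mul_self_sqrt zero_le_two]
    norm_num
  simp [dotProduct, mulVec, Fintype.sum_prod_type, Fin.sum_univ_two, ψ, Prod.ext_iff,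
    Complex.conj_ofReal]
  linear_combination (M 0 0 * N 0 0 * P 0 0 + M 0 1 * N 0 1 * P 0 1
    + M 1 0 * N 1 0 * P 1 0 + M 1 1 * N 1 1 * P 1 1) * h

/-- The GHZ state with the settings `A₁ = A₂ = σx`, `A₃ = σy`, `B₁ = B₂ = -σy`,
`B₃ = σx`, `Cᵢ = Bᵢ` attains the value `F1 = -8`. -/
theorem stmt_12 :
    let A : Fin 4 → Matrix (Fin 2) (Fin 2) ℂ := ![1, σx, σx, σy]
    let B : Fin 4 → Matrix (Fin 2) (Fin 2) ℂ := ![1, -σy, -σy, σx]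
    let C : Fin 4 → Matrix (Fin 2) (Fin 2) ℂ := ![1, -σy, -σy, σx]
    let E : Fin 4 → Fin 4 → Fin 4 → ℝ := fun i j k =>
      (star ψ ⬝ᵥ (A i ⊗ₖ (B j ⊗ₖ C k)).mulVec ψ).re
    F1 E = -8 := by
  intro A B C E
  simp only [F1, E, ghz_expectation]
  simp [A, B, C, σx, σy]
  norm_num

end Stmt12
end

section
/- Let d_A, d_B, d_C be positive integers. For i = 1,2,3 let A_i be a Hermitian d_A×d_A complex matrix with A_i² equal to the identity, and similarly let B_j (j = 1,2,3) be Hermitian d_B×d_B matrices and C_k (k = 1,2,3) Hermitian d_C×d_C matrices with squares equal to the identity; set A_0, B_0, C_0 equal to the respective identity matrices. Let ψ ∈ ℂ^{d_A·d_B·d_C} be a unit vector and define E(i,j,k) = Re⟨ψ, (A_i ⊗ B_j ⊗ C_k) ψ⟩ (Kronecker product, standard Hermitian inner product). Then F1(E) ≥ −8. -/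
open Matrix Kronecker

lemma sq_add_add_sq_sub_of_involutive {R : Type*} [Ring R] {x y : R} (hx : x * x = 1) (hy : y * y = 1) :
    (x + y) * (x + y) + (x - y) * (x - y) = 4 := by
  simp only [add_mul, mul_add, sub_mul, mul_sub, hx, hy]
  abel_nf
  norm_num

section PositiveFunctional

variable {R : Type*} [Ring R] [StarRing R] [Algebra ℝ R] {φ : R →ₗ[ℝ] ℝ}

lemma apply_mul_self_nonneg (hφ : ∀ x, 0 ≤ φ (star x * x)) {x : R} (hx : IsSelfAdjoint x) :
    0 ≤ φ (x * x) := by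
  simpa [hx.star_eq] using hφ x

/-- The arithmetic–geometric mean inequality for commuting self-adjoint elements. -/
lemma two_mul_apply_mul_le (hφ : ∀ x, 0 ≤ φ (star x * x)) {u v : R}
    (hu : IsSelfAdjoint u) (hv : IsSelfAdjoint v) (huv : Commute u v) :
    2 * φ (u * v) ≤ φ (u * u) + φ (v * v) := by
  have h := apply_mul_self_nonneg hφ (hu.sub hv)
  simp only [sub_mul, mul_sub, map_sub, ← huv.eq] at h
  linarith

/-- If `r ^ 2 ≤ 4`, then `|φ (p q r)| ≤ φ (p ^ 2) + φ (q ^ 2)` for commuting `p`, `q`, `r`. -/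
lemma abs_apply_mul_mul_le (hφ : ∀ x, 0 ≤ φ (star x * x)) {p q r t : R}
    (hp : IsSelfAdjoint p) (hq : IsSelfAdjoint q) (hr : IsSelfAdjoint r) (ht : IsSelfAdjoint t)
    (hpq : Commute p q) (hpr : Commute p r) (hqr : Commute q r) (hqt : Commute q t)
    (hrt : r * r + t * t = 4) :
    |φ (p * (q * r))| ≤ φ (p * p) + φ (q * q) := by
  have hqr_sa : IsSelfAdjoint (q * r) := (hq.commute_iff hr).1 hqr
  have hqt_sa : IsSelfAdjoint (q * t) := (hq.commute_iff ht).1 hqt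
  have hcomm : Commute p (q * r) := hpq.mul_right hpr
  have hqt_nonneg := apply_mul_self_nonneg hφ hqt_sa
  have hsplit : φ (q * r * (q * r)) + φ (q * t * (q * t)) = 4 * φ (q * q) := by
    rw [hqr.symm.mul_mul_mul_comm, hqt.symm.mul_mul_mul_comm, ← map_add, ← mul_add, hrt,
      show q * q * (4 : R) = (4 : ℝ) • (q * q) by
        rw [Algebra.smul_def, map_ofNat, (Commute.ofNat_left 4 (q * q)).eq], map_smul, smul_eq_mul]
  have hadd := apply_mul_self_nonneg hφ ((hp.add hp).add hqr_sa)
  have hsub := apply_mul_self_nonneg hφ ((hp.add hp).sub hqr_sa)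
  simp only [add_mul, mul_add, sub_mul, mul_sub, map_sub, map_add, ← hcomm.eq] at hadd hsub
  rw [abs_le]
  constructor <;> linarith

lemma four_mul_apply_mul_le (hφ : ∀ x, 0 ≤ φ (star x * x)) (hφ1 : φ 1 = 1) {x y s : R}
    (hx : IsSelfAdjoint x) (hy : IsSelfAdjoint y) (hs : IsSelfAdjoint s)
    (hxx : x * x = 1) (hyy : y * y = 1)
    (hxy : Commute x y) (hxs : Commute x s) (hys : Commute y s) :
    4 * φ (x * y * s) ≤ 4 + φ (s * s) := by
  have hxy_sa : IsSelfAdjoint (x * y) := (hx.commute_iff hy).1 hxy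
  have hcomm : Commute (x * y) s := hxs.mul_left hys
  have h := two_mul_apply_mul_le hφ (hxy_sa.add hxy_sa) hs (hcomm.add_left hcomm)
  have hsq : x * y * (x * y) = 1 := by
    rw [hxy.symm.mul_mul_mul_comm, hxx, hyy, one_mul]
  simp only [add_mul, mul_add, map_add, hsq, hφ1] at h
  linarith

lemma apply_add_add_sq_nonneg (hφ : ∀ x, 0 ≤ φ (star x * x)) {x y z : R}
    (hx : IsSelfAdjoint x) (hy : IsSelfAdjoint y) (hz : IsSelfAdjoint z)
    (hxy : Commute x y) (hxz : Commute x z) (hyz : Commute y z) :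
    0 ≤ φ (x * x) + φ (y * y) + φ (z * z) + 2 * (φ (x * y) + φ (x * z) + φ (y * z)) := by
  have h := apply_mul_self_nonneg hφ ((hx.add hy).add hz)
  simp only [add_mul, mul_add, map_add, ← hxy.eq, ← hxz.eq, ← hyz.eq] at h
  linarith

/-- The bound `F1 ≥ -8` for commuting triples of involutive observables and a state `φ`. -/
theorem neg_eight_le_F1_of_commute (hφ : ∀ x, 0 ≤ φ (star x * x)) (hφ1 : φ 1 = 1)
    {a b c : Fin 4 → R} (ha0 : a 0 = 1) (hb0 : b 0 = 1) (hc0 : c 0 = 1)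
    (ha : ∀ i, IsSelfAdjoint (a i)) (hb : ∀ i, IsSelfAdjoint (b i))
    (hc : ∀ i, IsSelfAdjoint (c i))
    (haa : ∀ i, a i * a i = 1) (hbb : ∀ i, b i * b i = 1) (hcc : ∀ i, c i * c i = 1)
    (hab : ∀ i j, Commute (a i) (b j)) (hac : ∀ i j, Commute (a i) (c j))
    (hbc : ∀ i j, Commute (b i) (c j)) :
    -8 ≤ F1 (fun i j k => φ (a i * (b j * c k))) := by
  have sa_add {f : Fin 4 → R} (hf : ∀ i, IsSelfAdjoint (f i)) : IsSelfAdjoint (f 1 + f 2) :=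
    (hf 1).add (hf 2)
  have sa_sub {f : Fin 4 → R} (hf : ∀ i, IsSelfAdjoint (f i)) : IsSelfAdjoint (f 1 - f 2) :=
    (hf 1).sub (hf 2)
  have comm_add {x : R} {f : Fin 4 → R} (h : ∀ i, Commute x (f i)) : Commute x (f 1 + f 2) :=
    (h 1).add_right (h 2)
  have comm_sub {x : R} {f : Fin 4 → R} (h : ∀ i, Commute x (f i)) : Commute x (f 1 - f 2) :=
    (h 1).sub_right (h 2)
  have comm_add_add {f g : Fin 4 → R} (h : ∀ i j, Commute (f i) (g j)) :
      Commute (f 1 + f 2) (g 1 + g 2) := (comm_add (h 1)).add_left (comm_add (h 2))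
  have comm_add_sub {f g : Fin 4 → R} (h : ∀ i j, Commute (f i) (g j)) :
      Commute (f 1 + f 2) (g 1 - g 2) := (comm_sub (h 1)).add_left (comm_sub (h 2))
  have comm_sub_add {f g : Fin 4 → R} (h : ∀ i j, Commute (f i) (g j)) :
      Commute (f 1 - f 2) (g 1 + g 2) := (comm_add (h 1)).sub_left (comm_add (h 2))
  have comm_sub_sub {f g : Fin 4 → R} (h : ∀ i j, Commute (f i) (g j)) :
      Commute (f 1 - f 2) (g 1 - g 2) := (comm_sub (h 1)).sub_left (comm_sub (h 2))
  have sq_sum {f : Fin 4 → R} (hff : ∀ i, f i * f i = 1) :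
      φ ((f 1 + f 2) * (f 1 + f 2)) + φ ((f 1 - f 2) * (f 1 - f 2)) = 4 := by
    rw [← map_add, sq_add_add_sq_sub_of_involutive (hff 1) (hff 2),
      show (4 : R) = (4 : ℝ) • 1 by rw [Algebra.smul_def, map_ofNat, mul_one], map_smul, hφ1]
    norm_num
  have triple {f g h : Fin 4 → R} (hf : ∀ i, IsSelfAdjoint (f i)) (hg : ∀ i, IsSelfAdjoint (g i))
      (hh : ∀ i, IsSelfAdjoint (h i)) (hhh : ∀ i, h i * h i = 1)
      (hfg : ∀ i j, Commute (f i) (g j)) (hfh : ∀ i j, Commute (f i) (h j))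
      (hgh : ∀ i j, Commute (g i) (h j)) :
      |φ ((f 1 + f 2) * ((g 1 + g 2) * (h 1 + h 2)))| ≤
          φ ((f 1 + f 2) * (f 1 + f 2)) + φ ((g 1 + g 2) * (g 1 + g 2)) ∧
        |φ ((f 1 - f 2) * ((g 1 - g 2) * (h 1 - h 2)))| ≤
          φ ((f 1 - f 2) * (f 1 - f 2)) + φ ((g 1 - g 2) * (g 1 - g 2)) := by
    have hsum := sq_add_add_sq_sub_of_involutive (hhh 1) (hhh 2)
    exact ⟨abs_apply_mul_mul_le hφ (sa_add hf) (sa_add hg) (sa_add hh) (sa_sub hh)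
        (comm_add_add hfg) (comm_add_add hfh) (comm_add_add hgh) (comm_add_sub hgh) hsum,
      abs_apply_mul_mul_le hφ (sa_sub hf) (sa_sub hg) (sa_sub hh) (sa_add hh)
        (comm_sub_sub hfg) (comm_sub_sub hfh) (comm_sub_sub hgh) (comm_sub_add hgh)
        (by rw [add_comm, hsum])⟩
  have hba i j : Commute (b i) (a j) := (hab j i).symm
  have hca i j : Commute (c i) (a j) := (hac j i).symm
  have hcb i j : Commute (c i) (b j) := (hbc j i).symm
  obtain ⟨hS_abc, hD_abc⟩ := triple ha hb hc hcc hab hac hbc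
  obtain ⟨hS_bca, hD_bca⟩ := triple hb hc ha haa hbc hba hca
  obtain ⟨hS_acb, hD_acb⟩ := triple ha hc hb hbb hac hab hcb
  rw [← mul_assoc, ((comm_add_add hba).mul_left (comm_add_add hca)).eq] at hS_bca
  rw [← mul_assoc, ((comm_sub_sub hba).mul_left (comm_sub_sub hca)).eq] at hD_bca
  rw [(comm_add_add hcb).eq] at hS_acb
  rw [(comm_sub_sub hcb).eq] at hD_acb
  have hS_lower := neg_le_of_abs_le hS_abc
  have hS_lower' := neg_le_of_abs_le hS_bca
  have hS_lower'' := neg_le_of_abs_le hS_acb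
  have hD_upper := le_of_abs_le hD_abc
  have hD_upper' := le_of_abs_le hD_bca
  have hD_upper'' := le_of_abs_le hD_acb
  have hpair_ab := four_mul_apply_mul_le hφ hφ1 (ha 3) (hb 3) (sa_add hc) (haa 3) (hbb 3)
    (hab 3 3) (comm_add (hac 3)) (comm_add (hbc 3))
  have hpair_ac := four_mul_apply_mul_le hφ hφ1 (ha 3) (hc 3) (sa_add hb) (haa 3) (hcc 3)
    (hac 3 3) (comm_add (hab 3)) (comm_add (hcb 3))
  have hpair_bc := four_mul_apply_mul_le hφ hφ1 (hb 3) (hc 3) (sa_add ha) (hbb 3) (hcc 3)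
    (hbc 3 3) (comm_add (hba 3)) (comm_add (hca 3))
  rw [mul_assoc, (comm_add (hcb 3)).eq] at hpair_ac
  rw [((comm_add (hba 3)).mul_left (comm_add (hca 3))).eq] at hpair_bc
  rw [mul_assoc] at hpair_ab
  have hD_sq := apply_add_add_sq_nonneg hφ (sa_sub ha) (sa_sub hb) (sa_sub hc)
    (comm_sub_sub hab) (comm_sub_sub hac) (comm_sub_sub hbc)
  have hsq_a := sq_sum haa
  have hsq_b := sq_sum hbb
  have hsq_c := sq_sum hcc
  simp only [F1, ha0, hb0, hc0, one_mul, mul_one]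
  simp only [add_mul, mul_add, sub_mul, mul_sub, map_add, map_sub] at *
  linarith

end PositiveFunctional

/-- The expectation value `Re ⟨ψ, M ψ⟩` as a linear functional of the matrix `M`. -/
def reExpectation {n : Type*} [Fintype n] (ψ : n → ℂ) : Matrix n n ℂ →ₗ[ℝ] ℝ where
  toFun M := (star ψ ⬝ᵥ M.mulVec ψ).re
  map_add' M N := by simp [add_mulVec]
  map_smul' r M := by simp [smul_mulVec]

open scoped ComplexOrder in
lemma reExpectation_star_mul_self_nonneg {n : Type*} [Fintype n] (ψ : n → ℂ)
    (M : Matrix n n ℂ) : 0 ≤ reExpectation ψ (star M * M) := by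
  have h := (posSemidef_conjTranspose_mul_self M).dotProduct_mulVec_nonneg ψ
  exact (Complex.le_def.1 h).1

/-- For any quantum realization — dichotomic ±1-valued observables (Hermitian matrices
squaring to the identity, with index 0 the trivial identity observable) for each party
and a joint unit state vector — the Bell expression F1 is bounded below by `-8`. -/
theorem stmt_14 (dA dB dC : ℕ) (hdA : 0 < dA) (hdB : 0 < dB) (hdC : 0 < dC)
    (A : Fin 4 → Matrix (Fin dA) (Fin dA) ℂ)
    (B : Fin 4 → Matrix (Fin dB) (Fin dB) ℂ)
    (C : Fin 4 → Matrix (Fin dC) (Fin dC) ℂ)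
    (hA0 : A 0 = 1) (hB0 : B 0 = 1) (hC0 : C 0 = 1)
    (hAherm : ∀ i, (A i).IsHermitian) (hAsq : ∀ i, A i * A i = 1)
    (hBherm : ∀ j, (B j).IsHermitian) (hBsq : ∀ j, B j * B j = 1)
    (hCherm : ∀ k, (C k).IsHermitian) (hCsq : ∀ k, C k * C k = 1)
    (ψ : Fin dA × Fin dB × Fin dC → ℂ) (hψ : star ψ ⬝ᵥ ψ = 1) :
    -8 ≤ F1 (fun i j k => (star ψ ⬝ᵥ (A i ⊗ₖ (B j ⊗ₖ C k)).mulVec ψ).re) := by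
  have hone : reExpectation ψ 1 = 1 := by simp [reExpectation, hψ]
  have key := neg_eight_le_F1_of_commute (reExpectation_star_mul_self_nonneg ψ) hone
    (a := fun i => A i ⊗ₖ (1 ⊗ₖ 1)) (b := fun j => 1 ⊗ₖ (B j ⊗ₖ 1))
    (c := fun k => 1 ⊗ₖ (1 ⊗ₖ C k)) (by simp [hA0]) (by simp [hB0]) (by simp [hC0])
    (fun i => by simp [IsSelfAdjoint, star_eq_conjTranspose, conjTranspose_kronecker, (hAherm i).eq])
    (fun j => by simp [IsSelfAdjoint, star_eq_conjTranspose, conjTranspose_kronecker, (hBherm j).eq])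
    (fun k => by simp [IsSelfAdjoint, star_eq_conjTranspose, conjTranspose_kronecker, (hCherm k).eq])
    (fun i => by simp [← mul_kronecker_mul, hAsq])
    (fun j => by simp [← mul_kronecker_mul, hBsq])
    (fun k => by simp [← mul_kronecker_mul, hCsq])
    (fun i j => by simp [Commute, SemiconjBy, ← mul_kronecker_mul])
    (fun i k => by simp [Commute, SemiconjBy, ← mul_kronecker_mul])
    (fun j k => by simp [Commute, SemiconjBy, ← mul_kronecker_mul])
  simp only [← mul_kronecker_mul, one_mul, mul_one] at key
  exact key
end

section
/- Let N be a positive integer, let α and β be finite nonempty types, and for each i ∈ {1,...,N} let p_i : α × β → ℝ be a nonnegative function. Suppose there is a function m : β → ℝ with m(y) > 0 for all y, such that Σ_{a ∈ α} p_i(a, y) = m(y) for every i and every y, and Σ_{y ∈ β} m(y) = 1. Define q : α^N × β → ℝ by q((a_1,...,a_N), y) = (Π_{i=1}^N p_i(a_i, y)) / m(y)^{N−1}. Then: (1) q is nonnegative; (2) Σ over all (a_1,...,a_N) ∈ α^N and y ∈ β of q equals 1; and (3) for every i, every a ∈ α and every y ∈ β, the marginal Σ_{(a_1,...,a_N) :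 a_i = a} q((a_1,...,a_N), y) equals p_i(a, y). -/
/-- Summing a product over all tuples with prescribed `i`-th coordinate `a` fixes the `i`-th factor
and sums out all the others. -/
theorem sum_filter_apply_eq_prod {ι α R : Type*} [Fintype ι] [DecidableEq ι] [Fintype α]
    [DecidableEq α] [CommSemiring R] (f : ι → α → R) (i : ι) (a : α) :
    ∑ as ∈ Finset.univ.filter (fun as : ι → α => as i = a), ∏ j, f j (as j)
      = f i a * ∏ j ∈ Finset.univ.erase i, ∑ b, f j b := by
  have hfilter : Finset.univ.filter (fun as : ι → α => as i = a)
      = Fintype.piFinset fun j => if j = i then {a} else Finset.univ := by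
    ext as
    simp only [Finset.mem_filter, Finset.mem_univ, true_and, Fintype.mem_piFinset]
    refine ⟨fun h j => ?_, fun h => by simpa using h i⟩
    split_ifs with hj
    · simpa [hj] using h
    · exact Finset.mem_univ _
  rw [hfilter, ← Finset.prod_univ_sum, ← Finset.mul_prod_erase _ _ (Finset.mem_univ i)]
  congr 1
  · simp
  · refine Finset.prod_congr rfl fun j hj => ?_
    rw [if_neg (Finset.ne_of_mem_erase hj)]

/-- Gluing `N` joint distributions `p i` of Alice's `i`-th outcome together with the
other parties' outcomes `y`, all sharing the same positive marginal `m` on `y`, into a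
single joint distribution `q` on all of Alice's outcomes simultaneously: `q` is a
probability distribution reproducing each `p i` as a marginal. -/
theorem stmt_15 (N : ℕ) (hN : 0 < N)
    (α β : Type) [Fintype α] [Nonempty α] [DecidableEq α] [Fintype β] [Nonempty β]
    (p : Fin N → α × β → ℝ) (hp : ∀ i x, 0 ≤ p i x)
    (m : β → ℝ) (hm : ∀ y, 0 < m y)
    (hmarg : ∀ i y, ∑ a, p i (a, y) = m y)
    (hsum : ∑ y, m y = 1) :
    let q : (Fin N → α) × β → ℝ := fun z => (∏ i, p i (z.1 i, z.2)) / m z.2 ^ (N - 1)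
    (∀ z, 0 ≤ q z) ∧
      (∑ as : Fin N → α, ∑ y, q (as, y)) = 1 ∧
      ∀ i a y, (∑ as ∈ Finset.univ.filter fun as : Fin N → α => as i = a, q (as, y))
        = p i (a, y) := by
  intro q
  refine ⟨fun z => div_nonneg (Finset.prod_nonneg fun i _ => hp i _) (pow_nonneg (hm _).le _),
    ?_, fun i a y => ?_⟩
  · rw [Finset.sum_comm, ← hsum]
    refine Finset.sum_congr rfl fun y _ => ?_
    have htotal : ∑ as : Fin N → α, ∏ i, p i (as i, y) = m y ^ N := by
      have h := Finset.prod_univ_sum (fun _ : Fin N => (Finset.univ : Finset α))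
        fun i a => p i (a, y)
      rw [Fintype.piFinset_univ] at h
      simp [← h, hmarg]
    simp only [q]
    rw [← Finset.sum_div, htotal, div_eq_iff (pow_pos (hm y) _).ne',
      mul_pow_sub_one hN.ne']
  · simp only [q]
    rw [← Finset.sum_div, sum_filter_apply_eq_prod fun j b => p j (b, y)]
    simp only [hmarg, Finset.prod_const, Finset.card_erase_of_mem (Finset.mem_univ i),
      Finset.card_univ, Fintype.card_fin]
    exact mul_div_cancel_right₀ _ (pow_pos (hm y) _).ne'
end

section
/- Let d_A, d_B, d_C be positive integers and let H be a positive semidefinite complex matrix of size (d_A·d_B·d_B·d_C·d_C) on the five systems A, B, B', C, C' (ordered as A ⊗ B ⊗ B' ⊗ C ⊗ C'), with trace 1. Let ρ be a complex matrix of size (d_A·d_B·d_C) such that for all matrices X (size d_A), Y (size d_B), Z (size d_C): Tr(H·(X ⊗ Y ⊗ 1 ⊗ Z ⊗ 1)) = Tr(ρ·(X ⊗ Y ⊗ Z)), and suppose H is symmetric under exchanging B with B' and C with C', in the sense that for all matrices X (size d_A), Y, Y' (size d_B), Z, Z' (size d_C): Tr(H·(X ⊗ Y ⊗ Y' ⊗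 Z ⊗ Z')) = Tr(H·(X ⊗ Y' ⊗ Y ⊗ Z' ⊗ Z)). Let {E_a}_{a ∈ 𝒜}, {F¹_b}_{b ∈ ℬ}, {F²_b}_{b ∈ ℬ}, {G¹_c}_{c ∈ 𝒞}, {G²_c}_{c ∈ 𝒞} be finite families of positive semidefinite matrices (of sizes d_A, d_B, d_B, d_C, d_C respectively), each family summing to the identity. Define p(a, b_1, b_2, c_1, c_2) = Tr(H·(E_a ⊗ F¹_{b_1} ⊗ F²_{b_2} ⊗ G¹_{c_1} ⊗ G²_{c_2})). Then: (1) p is real and nonnegative; (2) the sum of p over all (a, b_1, b_2, c_1, c_2) equals 1; (3) Σ_{b_2, c_2} p(a, b_1, b_2, c_1, c_2) = Tr(ρ·(E_a ⊗ F¹_{b_1} ⊗ G¹_{c_1})); and (4) Σ_{b_1, c_1} p(a, b_1, b_2, c_1, c_2) = Tr(ρ·(E_a ⊗ F²_{b_2} ⊗ G²_{c_2})). -/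
open Matrix Kronecker ComplexOrder

namespace Matrix

theorem kronecker_sum {ι l m n p R : Type*} [NonUnitalNonAssocSemiring R] (s : Finset ι)
    (A : Matrix l m R) (B : ι → Matrix n p R) :
    A ⊗ₖ (∑ i ∈ s, B i) = ∑ i ∈ s, A ⊗ₖ B i := by
  ext
  simp [sum_apply, Finset.mul_sum]

theorem sum_kronecker {ι l m n p R : Type*} [NonUnitalNonAssocSemiring R] (s : Finset ι)
    (A : ι → Matrix l m R) (B : Matrix n p R) :
    (∑ i ∈ s, A i) ⊗ₖ B = ∑ i ∈ s, A i ⊗ₖ B := by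
  ext
  simp [sum_apply, Finset.sum_mul]

open scoped MatrixOrder in
/-- The trace of a product of two positive semidefinite matrices is nonnegative. -/
theorem PosSemidef.trace_mul_nonneg {n : Type*} [Fintype n] {A B : Matrix n n ℂ}
    (hA : A.PosSemidef) (hB : B.PosSemidef) : 0 ≤ (A * B).trace := by
  classical
  obtain ⟨C, rfl⟩ := CStarAlgebra.nonneg_iff_eq_star_mul_self.mp hB.nonneg
  rw [star_eq_conjTranspose, ← Matrix.mul_assoc, trace_mul_comm, ← Matrix.mul_assoc]
  exact (hA.mul_mul_conjTranspose_same C).trace_nonneg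

end Matrix

/-- If a tripartite state `ρ` on `A ⊗ B ⊗ C` admits a symmetric extension `H` on
`A ⊗ B ⊗ B' ⊗ C ⊗ C'`, then for each fixed POVM of Alice and two alternative POVMs on
Bob's and on Charlie's systems, the probabilities defined by `H` form a joint
probability distribution whose marginals reproduce the quantum probabilities of `ρ`
for the two pairs of measurements. -/
theorem stmt_16 (dA dB dC : ℕ) (hdA : 0 < dA) (hdB : 0 < dB) (hdC : 0 < dC)
    (H : Matrix (Fin dA × Fin dB × Fin dB × Fin dC × Fin dC)
      (Fin dA × Fin dB × Fin dB × Fin dC × Fin dC) ℂ)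
    (hH : H.PosSemidef) (hHtr : H.trace = 1)
    (ρ : Matrix (Fin dA × Fin dB × Fin dC) (Fin dA × Fin dB × Fin dC) ℂ)
    (hred : ∀ (X : Matrix (Fin dA) (Fin dA) ℂ) (Y : Matrix (Fin dB) (Fin dB) ℂ)
        (Z : Matrix (Fin dC) (Fin dC) ℂ),
        (H * (X ⊗ₖ (Y ⊗ₖ ((1 : Matrix (Fin dB) (Fin dB) ℂ)
            ⊗ₖ (Z ⊗ₖ (1 : Matrix (Fin dC) (Fin dC) ℂ)))))).trace
          = (ρ * (X ⊗ₖ (Y ⊗ₖ Z))).trace)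
    (hsymm : ∀ (X : Matrix (Fin dA) (Fin dA) ℂ) (Y Y' : Matrix (Fin dB) (Fin dB) ℂ)
        (Z Z' : Matrix (Fin dC) (Fin dC) ℂ),
        (H * (X ⊗ₖ (Y ⊗ₖ (Y' ⊗ₖ (Z ⊗ₖ Z'))))).trace
          = (H * (X ⊗ₖ (Y' ⊗ₖ (Y ⊗ₖ (Z' ⊗ₖ Z))))).trace)
    (𝒜 ℬ 𝒞 : Type) [Fintype 𝒜] [Fintype ℬ] [Fintype 𝒞]
    (E : 𝒜 → Matrix (Fin dA) (Fin dA) ℂ)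
    (F₁ F₂ : ℬ → Matrix (Fin dB) (Fin dB) ℂ)
    (G₁ G₂ : 𝒞 → Matrix (Fin dC) (Fin dC) ℂ)
    (hE : ∀ a, (E a).PosSemidef) (hEsum : ∑ a, E a = 1)
    (hF₁ : ∀ b, (F₁ b).PosSemidef) (hF₁sum : ∑ b, F₁ b = 1)
    (hF₂ : ∀ b, (F₂ b).PosSemidef) (hF₂sum : ∑ b, F₂ b = 1)
    (hG₁ : ∀ c, (G₁ c).PosSemidef) (hG₁sum : ∑ c, G₁ c = 1)
    (hG₂ : ∀ c, (G₂ c).PosSemidef) (hG₂sum : ∑ c, G₂ c = 1) :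
    let p : 𝒜 → ℬ → ℬ → 𝒞 → 𝒞 → ℂ := fun a b₁ b₂ c₁ c₂ =>
      (H * (E a ⊗ₖ (F₁ b₁ ⊗ₖ (F₂ b₂ ⊗ₖ (G₁ c₁ ⊗ₖ G₂ c₂))))).trace
    (∀ a b₁ b₂ c₁ c₂, 0 ≤ (p a b₁ b₂ c₁ c₂).re ∧ (p a b₁ b₂ c₁ c₂).im = 0) ∧
      (∑ a, ∑ b₁, ∑ b₂, ∑ c₁, ∑ c₂, p a b₁ b₂ c₁ c₂) = 1 ∧
      (∀ a b₁ c₁, (∑ b₂, ∑ c₂, p a b₁ b₂ c₁ c₂)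
        = (ρ * (E a ⊗ₖ (F₁ b₁ ⊗ₖ G₁ c₁))).trace) ∧
      (∀ a b₂ c₂, (∑ b₁, ∑ c₁, p a b₁ b₂ c₁ c₂)
        = (ρ * (E a ⊗ₖ (F₂ b₂ ⊗ₖ G₂ c₂))).trace) := by
  intro p
  refine ⟨fun a b₁ b₂ c₁ c₂ => ?_, ?_, fun a b₁ c₁ => ?_, fun a b₂ c₂ => ?_⟩
  · have h := Complex.nonneg_iff.mp <| hH.trace_mul_nonneg <|
      (hE a).kronecker <| (hF₁ b₁).kronecker <| (hF₂ b₂).kronecker <|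
        (hG₁ c₁).kronecker (hG₂ c₂)
    exact ⟨h.1, h.2.symm⟩
  · simp only [p, ← trace_sum, ← Matrix.mul_sum, ← kronecker_sum, ← sum_kronecker,
      hEsum, hF₁sum, hF₂sum, hG₁sum, hG₂sum, one_kronecker_one, Matrix.mul_one, hHtr]
  · rw [← hred]
    simp only [p, ← trace_sum, ← Matrix.mul_sum, ← kronecker_sum, ← sum_kronecker,
      hF₂sum, hG₂sum]
  · rw [← hred, hsymm]
    simp only [p, ← trace_sum, ← Matrix.mul_sum, ← kronecker_sum, ← sum_kronecker,
      hF₁sum, hG₁sum]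
end
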